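/- For every real a ≥ 0, ∫_ℝ φ(x)·Φ(x)·Φ(a·x) dx = 1/4 + (1/(2π))·arctan( a / √(2+a²) ). -/

import Mathlib

open MeasureTheory Real

/-- The standard normal density. -/
noncomputable def stdNormalPDF (x : ℝ) : ℝ :=
  (1 / Real.sqrt (2 * Real.pi)) * Real.exp (-x^2 / 2)

/-- The standard normal cumulative distribution function. -/
noncomputable def stdNormalCDF (x : ℝ) : ℝ :=
  ∫ t in Set.Iic x, stdNormalPDF t

lemma stdNormalPDF_nonneg (x : ℝ) : 0 ≤ stdNormalPDF x := by
  unfold stdNormalPDF; positivity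

lemma stdNormalPDF_neg (x : ℝ) : stdNormalPDF (-x) = stdNormalPDF x := by
  simp [stdNormalPDF]

lemma continuous_stdNormalPDF : Continuous stdNormalPDF := by
  unfold stdNormalPDF; fun_prop

lemma stdNormalPDF_le_one (x : ℝ) : stdNormalPDF x ≤ 1 := by
  unfold stdNormalPDF
  have h1 : (1 : ℝ) ≤ √(2 * π) := by
    rw [Real.one_le_sqrt]; linarith [Real.pi_gt_three]
  have h2 : 1 / √(2 * π) ≤ 1 := by rw [div_le_one (by linarith)]; exact h1
  have h3 : Real.exp (-x ^ 2 / 2) ≤ 1 := by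
    rw [Real.exp_le_one_iff]; nlinarith [sq_nonneg x]
  exact mul_le_one₀ h2 (Real.exp_pos _).le h3

lemma stdNormalPDF_eq (x : ℝ) :
    stdNormalPDF x = (1 / √(2 * π)) * Real.exp (-(1 / 2) * x ^ 2) := by
  unfold stdNormalPDF; congr 2; ring

lemma integrable_stdNormalPDF : Integrable stdNormalPDF := by
  rw [funext stdNormalPDF_eq]
  exact (integrable_exp_neg_mul_sq (by norm_num)).const_mul _

lemma integral_stdNormalPDF : ∫ x, stdNormalPDF x = 1 := by
  simp_rw [stdNormalPDF_eq]
  rw [integral_const_mul, integral_gaussian, show π / (1 / 2) = 2 * π by ring]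
  have : √(2 * π) ≠ 0 := by positivity
  field_simp

lemma integrable_mul_stdNormalPDF : Integrable (fun x : ℝ => x * stdNormalPDF x) := by
  have h : (fun x : ℝ => x * stdNormalPDF x)
      = fun x => (1 / √(2 * π)) * (x * Real.exp (-(1 / 2) * x ^ 2)) := by
    funext x; rw [stdNormalPDF_eq]; ring
  rw [h]
  exact (integrable_mul_exp_neg_mul_sq (by norm_num)).const_mul _

lemma stdNormalCDF_nonneg (x : ℝ) : 0 ≤ stdNormalCDF x :=
  integral_nonneg stdNormalPDF_nonneg

lemma stdNormalCDF_le_one (x : ℝ) : stdNormalCDF x ≤ 1 := by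
  rw [← integral_stdNormalPDF]
  exact setIntegral_le_integral integrable_stdNormalPDF (.of_forall stdNormalPDF_nonneg)

lemma hasDerivAt_stdNormalCDF (x : ℝ) : HasDerivAt stdNormalCDF (stdNormalPDF x) x := by
  have h : stdNormalCDF = fun y => stdNormalCDF 0 + ∫ t in (0 : ℝ)..y, stdNormalPDF t := by
    funext y
    rw [← intervalIntegral.integral_Iic_sub_Iic integrable_stdNormalPDF.integrableOn
      integrable_stdNormalPDF.integrableOn]
    simp only [stdNormalCDF]; ring
  rw [h]
  exact (intervalIntegral.integral_hasDerivAt_right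
    (continuous_stdNormalPDF.intervalIntegrable _ _)
    (continuous_stdNormalPDF.stronglyMeasurableAtFilter _ _)
    continuous_stdNormalPDF.continuousAt).const_add _

lemma continuous_stdNormalCDF : Continuous stdNormalCDF :=
  continuous_iff_continuousAt.2 fun x => (hasDerivAt_stdNormalCDF x).continuousAt

lemma stdNormalCDF_neg (x : ℝ) : stdNormalCDF (-x) = 1 - stdNormalCDF x := by
  have h1 : stdNormalCDF (-x) = ∫ t in Set.Ioi x, stdNormalPDF t := by
    have h := integral_comp_neg_Iic (-x) stdNormalPDF
    simp_rw [stdNormalPDF_neg, neg_neg] at h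
    exact h
  have h2 := intervalIntegral.integral_Iic_add_Ioi (b := x) (μ := volume)
    integrable_stdNormalPDF.integrableOn integrable_stdNormalPDF.integrableOn
  rw [integral_stdNormalPDF] at h2
  rw [h1, stdNormalCDF]; linarith

/-- Multiplying by a value of the normal distribution function preserves integrability. -/
lemma MeasureTheory.Integrable.mul_stdNormalCDF {f : ℝ → ℝ} (hf : Integrable f) (b : ℝ) :
    Integrable (fun x => f x * stdNormalCDF (b * x)) := by
  refine hf.mul_bdd (c := 1)
    (continuous_stdNormalCDF.comp (continuous_const_mul b)).aestronglyMeasurable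
    (.of_forall fun x => ?_)
  rw [Real.norm_of_nonneg (stdNormalCDF_nonneg _)]
  exact stdNormalCDF_le_one _

lemma integrable_pdf_mul_cdf : Integrable (fun x => stdNormalPDF x * stdNormalCDF x) := by
  simpa using integrable_stdNormalPDF.mul_stdNormalCDF 1

lemma integral_pdf_mul_cdf : ∫ x, stdNormalPDF x * stdNormalCDF x = 1 / 2 := by
  have h := integral_neg_eq_self (fun x => stdNormalPDF x * stdNormalCDF x) volume
  simp_rw [stdNormalPDF_neg, stdNormalCDF_neg, mul_sub, mul_one] at h
  rw [integral_sub integrable_stdNormalPDF integrable_pdf_mul_cdf, integral_stdNormalPDF] at h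
  linarith

lemma integral_mul_exp_mul_cdf {c : ℝ} (hc : 0 < c) :
    ∫ x, stdNormalCDF x * (x * Real.exp (-(c / 2) * x ^ 2)) = 1 / (c * √(c + 1)) := by
  have hv (x : ℝ) : HasDerivAt (fun x : ℝ => -(1 / c) * Real.exp (-(c / 2) * x ^ 2))
      (x * Real.exp (-(c / 2) * x ^ 2)) x := by
    have := ((((hasDerivAt_id x).pow 2).const_mul (-(c / 2))).exp).const_mul (-(1 / c))
    refine this.congr_deriv ?_
    simp only [id, Pi.pow_apply]
    field_simp
    simp
  have hprod (x : ℝ) : stdNormalPDF x * (-(1 / c) * Real.exp (-(c / 2) * x ^ 2))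
      = -(1 / c) * (1 / √(2 * π)) * Real.exp (-((c + 1) / 2) * x ^ 2) := by
    rw [stdNormalPDF_eq, show -((c + 1) / 2) * x ^ 2 = -(1 / 2) * x ^ 2 + -(c / 2) * x ^ 2 by ring,
      Real.exp_add]
    ring
  have hexp : Integrable (fun x : ℝ => Real.exp (-(c / 2) * x ^ 2)) :=
    integrable_exp_neg_mul_sq (by positivity)
  have hxexp : Integrable (fun x : ℝ => x * Real.exp (-(c / 2) * x ^ 2)) :=
    integrable_mul_exp_neg_mul_sq (by positivity)
  have key := integral_mul_deriv_eq_deriv_mul_of_integrable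
    (u := stdNormalCDF) (u' := stdNormalPDF)
    (fun x _ => hasDerivAt_stdNormalCDF x) (fun x _ => hv x)
    (by simpa [mul_comm, Pi.mul_def] using hxexp.mul_stdNormalCDF 1)
    (by
      rw [Pi.mul_def, funext hprod]
      exact (integrable_exp_neg_mul_sq (by positivity)).const_mul _)
    (by simpa [mul_comm, Pi.mul_def] using (hexp.const_mul (-(1 / c))).mul_stdNormalCDF 1)
  rw [key]
  simp_rw [hprod]
  rw [integral_const_mul, integral_gaussian,
    show π / ((c + 1) / 2) = (2 * π) / (c + 1) by field_simp,
    Real.sqrt_div (by positivity)]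
  have : √(2 * π) ≠ 0 := by positivity
  field_simp

lemma hasDerivAt_integral_pdf_cdf_cdf (a : ℝ) :
    HasDerivAt (fun b : ℝ => ∫ x, stdNormalPDF x * stdNormalCDF x * stdNormalCDF (b * x))
      (1 / (2 * π) * (1 / ((1 + a ^ 2) * √(2 + a ^ 2)))) a := by
  have hcont : Continuous fun x => stdNormalPDF x * stdNormalCDF x :=
    continuous_stdNormalPDF.mul continuous_stdNormalCDF
  have h := (hasDerivAt_integral_of_dominated_loc_of_deriv_le (μ := volume) (x₀ := a)
    (s := Set.univ)
    (F := fun b x => stdNormalPDF x * stdNormalCDF x * stdNormalCDF (b * x))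
    (F' := fun b x => stdNormalPDF x * stdNormalCDF x * (stdNormalPDF (b * x) * x))
    (bound := fun x => ‖x * stdNormalPDF x‖) Filter.univ_mem
    (.of_forall fun b => (integrable_pdf_mul_cdf.mul_stdNormalCDF b).aestronglyMeasurable)
    (integrable_pdf_mul_cdf.mul_stdNormalCDF a)
    (hcont.mul ((continuous_stdNormalPDF.comp (continuous_const_mul a)).mul
      continuous_id)).aestronglyMeasurable
    (.of_forall fun x b _ => ?_) integrable_mul_stdNormalPDF.norm
    (.of_forall fun x b _ => ?_)).2
  · refine h.congr_deriv ?_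
    have hc : 0 < 1 + a ^ 2 := by positivity
    have hI := integral_mul_exp_mul_cdf hc
    rw [show 1 + a ^ 2 + 1 = 2 + a ^ 2 by ring] at hI
    rw [← hI, ← integral_const_mul]
    refine integral_congr_ae (.of_forall fun x => ?_)
    have hs : (1 / √(2 * π)) * (1 / √(2 * π)) = 1 / (2 * π) := by
      rw [div_mul_div_comm, Real.mul_self_sqrt (by positivity), one_mul]
    have he : -((1 + a ^ 2) / 2) * x ^ 2 = -(1 / 2) * x ^ 2 + -(1 / 2) * (a * x) ^ 2 := by ring
    simp only [stdNormalPDF_eq]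
    rw [← hs, he, Real.exp_add]
    ring
  · simp only [norm_mul, Real.norm_of_nonneg (stdNormalPDF_nonneg _),
      Real.norm_of_nonneg (stdNormalCDF_nonneg _)]
    calc stdNormalPDF x * stdNormalCDF x * (stdNormalPDF (b * x) * ‖x‖)
        ≤ stdNormalPDF x * 1 * (1 * ‖x‖) := by
          have := stdNormalPDF_nonneg x
          have := stdNormalPDF_nonneg (b * x)
          gcongr
          · exact stdNormalCDF_le_one x
          · exact stdNormalPDF_le_one _
      _ = ‖x‖ * stdNormalPDF x := by ring
  · have := (hasDerivAt_stdNormalCDF (b * x)).comp b ((hasDerivAt_id b).mul_const x)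
    simpa [Function.comp_def] using this.const_mul (stdNormalPDF x * stdNormalCDF x)

lemma hasDerivAt_arctan_div_sqrt_two_add_sq (a : ℝ) :
    HasDerivAt (fun b : ℝ => Real.arctan (b / √(2 + b ^ 2)))
      (1 / ((1 + a ^ 2) * √(2 + a ^ 2))) a := by
  have hp : 0 < 2 + a ^ 2 := by positivity
  have hs : 0 < √(2 + a ^ 2) := Real.sqrt_pos.2 hp
  have hsq : √(2 + a ^ 2) ^ 2 = 2 + a ^ 2 := Real.sq_sqrt hp.le
  have h1 : HasDerivAt (fun b : ℝ => √(2 + b ^ 2)) (a / √(2 + a ^ 2)) a := by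
    refine ((((hasDerivAt_id a).pow 2).const_add 2).sqrt hp.ne').congr_deriv ?_
    simp only [id, Pi.pow_apply]
    field_simp
    simp
  refine (((hasDerivAt_id a).div h1 hs.ne').arctan).congr_deriv ?_
  have h2 : 1 + (a / √(2 + a ^ 2)) ^ 2 = 2 * (1 + a ^ 2) / (2 + a ^ 2) := by
    rw [div_pow, hsq]; field_simp; ring
  have h3 : 1 * √(2 + a ^ 2) - a * (a / √(2 + a ^ 2)) = 2 / √(2 + a ^ 2) := by
    field_simp; rw [hsq]; ring
  simp only [id, Pi.div_apply]
  rw [h2, h3, hsq]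
  field_simp

/-- For every `a ≥ 0`, `∫ φ(x) Φ(x) Φ(ax) dx = 1/4 + (1/(2π)) arctan(a/√(2+a²))`. -/
theorem integral_pdf_cdf_cdf (a : ℝ) (ha : 0 ≤ a) :
    (∫ x : ℝ, stdNormalPDF x * stdNormalCDF x * stdNormalCDF (a * x))
      = 1/4 + (1/(2 * Real.pi)) * Real.arctan (a / Real.sqrt (2 + a^2)) := by
  have hd (b : ℝ) := (hasDerivAt_integral_pdf_cdf_cdf b).sub
    ((hasDerivAt_arctan_div_sqrt_two_add_sq b).const_mul (1 / (2 * π)))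
  have hconst := is_const_of_deriv_eq_zero (fun b => (hd b).differentiableAt)
    (fun b => (hd b).deriv.trans (sub_self _)) a 0
  have h0 : stdNormalCDF 0 = 1 / 2 := by
    have := stdNormalCDF_neg 0
    rw [neg_zero] at this
    linarith
  simp only [Pi.sub_apply, zero_mul, h0, zero_div, Real.arctan_zero, mul_zero, sub_zero,
    integral_mul_const, integral_pdf_mul_cdf] at hconst
  linarith
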